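/- Let p ≥ 5 be a prime and let M be the Lie ring ⟨a, b | [b,a,b] − [b,a,a,a,a], [b,a,a,a,b] − [b,a,a,a,a,a], p•a, p•b, class 6⟩, i.e., the quotient of the free Lie ring on generators a, b by the Lie ideal generated by the listed elements together with the 7th term of the lower central series. Then the number of isomorphism classes of Lie rings L of cardinality p^8, nilpotent of class exactly 7, with L/L⁷ ≅ M equals p². -/

import Mathlib

/-- An isomorphism between two Lie rings (Lie algebras over `ℤ`) exists. -/
def IsLieIso (α β : Type*) [LieRing α] [LieRing β] : Prop :=
  ∃ e : α ≃ β, (∀ x y, e (x + y) = e x + e y) ∧ (∀ x y, e ⁅x, y⁆ = ⁅e x, e y⁆)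

/-- A Lie ring is nilpotent of class exactly `c`: `L^{c+1} = 0` and `L^c ≠ 0`. -/
def LieClassEq (α : Type*) [LieRing α] (c : ℕ) : Prop :=
  LieModule.lowerCentralSeries ℤ α α c = ⊥ ∧ LieModule.lowerCentralSeries ℤ α α (c - 1) ≠ ⊥

/-- The free Lie ring on two generators. -/
abbrev FL : Type := FreeLieAlgebra ℤ (Fin 2)

/-- The generator `a`. -/
noncomputable def ga : FL := FreeLieAlgebra.of ℤ 0
/-- The generator `b`. -/
noncomputable def gb : FL := FreeLieAlgebra.of ℤ 1
/-- The left-normed bracket `[b,a,b]`. -/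
noncomputable def bab : FL := ⁅⁅gb, ga⁆, gb⁆
/-- The left-normed bracket `[b,a,a,a]`. -/
noncomputable def ba3 : FL := ⁅⁅⁅gb, ga⁆, ga⁆, ga⁆
/-- The left-normed bracket `[b,a,a,a,b]`. -/
noncomputable def ba3b : FL := ⁅ba3, gb⁆
/-- The left-normed bracket `[b,a,a,a,a]`. -/
noncomputable def ba4 : FL := ⁅ba3, ga⁆
/-- The left-normed bracket `[b,a,a,a,a,a]`. -/
noncomputable def ba5 : FL := ⁅ba4, ga⁆

/-- The quotient of the free Lie ring on `a, b` by the Lie ideal generated by the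
given relator set together with `p•a`, `p•b` and the 7th term of the lower central
series (i.e. the presentation is of class at most 6). -/
abbrev presLie (p : ℕ) (rels : Set FL) : Type :=
  FL ⧸ (LieSubmodule.lieSpan ℤ FL (rels ∪ {p • ga, p • gb}) ⊔
    LieModule.lowerCentralSeries ℤ FL FL 6)

/-- `s` is a Lie ring structure of maximal class 7 on a set of size `p^8` whose
quotient by the 7th term of the lower central series is isomorphic to `β`. -/
def IsMaxClassDescendantOf (p : ℕ) (β : Type*) [LieRing β]
    (s : LieRing (Fin (p ^ 8))) : Prop := by
  letI := s
  exact LieClassEq (Fin (p ^ 8)) 7 ∧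
    IsLieIso (Fin (p ^ 8) ⧸ LieModule.lowerCentralSeries ℤ (Fin (p ^ 8)) (Fin (p ^ 8)) 6) β

/-- The free `R`-module on `a, b, v₂, …, v₇, X, Y`, carrying the Lie bracket in which
`v₂ = [b,a]`, `vᵢ₊₁ = [vᵢ,a]`, `[v₂,b] = v₅ + X`, `[v₄,b] = v₆ + Y` and `v₇`, `X`, `Y` are
central. -/
@[ext]
structure Cover (R : Type*) where
  /-- coefficient of `a` -/
  a : R
  /-- coefficient of `b` -/
  b : R
  /-- coefficient of `v₂` -/
  c2 : R
  /-- coefficient of `v₃` -/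
  c3 : R
  /-- coefficient of `v₄` -/
  c4 : R
  /-- coefficient of `v₅` -/
  c5 : R
  /-- coefficient of `v₆` -/
  c6 : R
  /-- coefficient of `v₇` -/
  c7 : R
  /-- coefficient of `X` -/
  x : R
  /-- coefficient of `Y` -/
  y : R

namespace Cover

section Ring

variable {R : Type*} [CommRing R]

instance : Add (Cover R) :=
  ⟨fun u v => ⟨u.a + v.a, u.b + v.b, u.c2 + v.c2, u.c3 + v.c3, u.c4 + v.c4, u.c5 + v.c5,
    u.c6 + v.c6, u.c7 + v.c7, u.x + v.x, u.y + v.y⟩⟩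

instance : Zero (Cover R) := ⟨⟨0, 0, 0, 0, 0, 0, 0, 0, 0, 0⟩⟩

instance : Neg (Cover R) :=
  ⟨fun u => ⟨-u.a, -u.b, -u.c2, -u.c3, -u.c4, -u.c5, -u.c6, -u.c7, -u.x, -u.y⟩⟩

instance : Sub (Cover R) :=
  ⟨fun u v => ⟨u.a - v.a, u.b - v.b, u.c2 - v.c2, u.c3 - v.c3, u.c4 - v.c4, u.c5 - v.c5,
    u.c6 - v.c6, u.c7 - v.c7, u.x - v.x, u.y - v.y⟩⟩

instance : SMul ℕ (Cover R) :=
  ⟨fun n u => ⟨n * u.a, n * u.b, n * u.c2, n * u.c3, n * u.c4, n * u.c5, n * u.c6, n * u.c7,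
    n * u.x, n * u.y⟩⟩

instance : SMul ℤ (Cover R) :=
  ⟨fun n u => ⟨n * u.a, n * u.b, n * u.c2, n * u.c3, n * u.c4, n * u.c5, n * u.c6, n * u.c7,
    n * u.x, n * u.y⟩⟩

instance : Bracket (Cover R) (Cover R) :=
  ⟨fun u v => ⟨0, 0,
    u.b * v.a - u.a * v.b,
    u.c2 * v.a - u.a * v.c2,
    u.c3 * v.a - u.a * v.c3,
    u.c4 * v.a - u.a * v.c4 + (u.c2 * v.b - u.b * v.c2),
    u.c5 * v.a - u.a * v.c5 + (u.c3 * v.b - u.b * v.c3) + (u.c4 * v.b - u.b * v.c4)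
      - (u.c3 * v.c2 - u.c2 * v.c3),
    u.c6 * v.a - u.a * v.c6 + 2 * (u.c5 * v.b - u.b * v.c5) + (u.c3 * v.c2 - u.c2 * v.c3)
      - (u.c4 * v.c2 - u.c2 * v.c4),
    u.c2 * v.b - u.b * v.c2,
    u.c4 * v.b - u.b * v.c4 - (u.c3 * v.c2 - u.c2 * v.c3)⟩⟩

theorem add_def (u v : Cover R) : u + v = ⟨u.a + v.a, u.b + v.b, u.c2 + v.c2, u.c3 + v.c3,
    u.c4 + v.c4, u.c5 + v.c5, u.c6 + v.c6, u.c7 + v.c7, u.x + v.x, u.y + v.y⟩ := rfl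

theorem zero_def : (0 : Cover R) = ⟨0, 0, 0, 0, 0, 0, 0, 0, 0, 0⟩ := rfl

theorem neg_def (u : Cover R) :
    -u = ⟨-u.a, -u.b, -u.c2, -u.c3, -u.c4, -u.c5, -u.c6, -u.c7, -u.x, -u.y⟩ := rfl

theorem sub_def (u v : Cover R) : u - v = ⟨u.a - v.a, u.b - v.b, u.c2 - v.c2, u.c3 - v.c3,
    u.c4 - v.c4, u.c5 - v.c5, u.c6 - v.c6, u.c7 - v.c7, u.x - v.x, u.y - v.y⟩ := rfl

theorem nsmul_def (n : ℕ) (u : Cover R) : n • u = ⟨n * u.a, n * u.b, n * u.c2, n * u.c3,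
    n * u.c4, n * u.c5, n * u.c6, n * u.c7, n * u.x, n * u.y⟩ := rfl

theorem zsmul_def (n : ℤ) (u : Cover R) : n • u = ⟨n * u.a, n * u.b, n * u.c2, n * u.c3,
    n * u.c4, n * u.c5, n * u.c6, n * u.c7, n * u.x, n * u.y⟩ := rfl

theorem lie_def (u v : Cover R) : ⁅u, v⁆ = ⟨0, 0,
    u.b * v.a - u.a * v.b,
    u.c2 * v.a - u.a * v.c2,
    u.c3 * v.a - u.a * v.c3,
    u.c4 * v.a - u.a * v.c4 + (u.c2 * v.b - u.b * v.c2),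
    u.c5 * v.a - u.a * v.c5 + (u.c3 * v.b - u.b * v.c3) + (u.c4 * v.b - u.b * v.c4)
      - (u.c3 * v.c2 - u.c2 * v.c3),
    u.c6 * v.a - u.a * v.c6 + 2 * (u.c5 * v.b - u.b * v.c5) + (u.c3 * v.c2 - u.c2 * v.c3)
      - (u.c4 * v.c2 - u.c2 * v.c4),
    u.c2 * v.b - u.b * v.c2,
    u.c4 * v.b - u.b * v.c4 - (u.c3 * v.c2 - u.c2 * v.c3)⟩ := rfl

instance : AddCommGroup (Cover R) where
  add_assoc u v w := by simp only [add_def, add_assoc]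
  zero_add u := by simp only [add_def, zero_def, zero_add]
  add_zero u := by simp only [add_def, zero_def, add_zero]
  add_comm u v := by simp only [add_def, add_comm]
  neg_add_cancel u := by simp only [add_def, neg_def, zero_def, neg_add_cancel]
  sub_eq_add_neg u v := by simp only [add_def, neg_def, sub_def, sub_eq_add_neg]
  nsmul n u := n • u
  nsmul_zero u := by simp [nsmul_def, zero_def]
  nsmul_succ n u := by simp [nsmul_def, add_def, add_mul]
  zsmul n u := n • u
  zsmul_zero' u := by simp [zsmul_def, zero_def]
  zsmul_succ' n u := by simp [zsmul_def, add_def, add_mul]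
  zsmul_neg' n u := by ext <;> simp [zsmul_def, neg_def] <;> ring

instance : LieRing (Cover R) where
  add_lie u v w := by ext <;> simp only [lie_def, add_def] <;> ring
  lie_add u v w := by ext <;> simp only [lie_def, add_def] <;> ring
  lie_self u := by ext <;> simp only [lie_def, zero_def] <;> ring
  leibniz_lie u v w := by ext <;> simp only [lie_def, add_def] <;> ring

end Ring

/-- The basis vector `a`. -/
def ea : Cover ℤ := ⟨1, 0, 0, 0, 0, 0, 0, 0, 0, 0⟩
/-- The basis vector `b`. -/
def eb : Cover ℤ := ⟨0, 1, 0, 0, 0, 0, 0, 0, 0, 0⟩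
/-- The basis vector `v₂`. -/
def e2 : Cover ℤ := ⟨0, 0, 1, 0, 0, 0, 0, 0, 0, 0⟩
/-- The basis vector `v₃`. -/
def e3 : Cover ℤ := ⟨0, 0, 0, 1, 0, 0, 0, 0, 0, 0⟩
/-- The basis vector `v₄`. -/
def e4 : Cover ℤ := ⟨0, 0, 0, 0, 1, 0, 0, 0, 0, 0⟩
/-- The basis vector `v₅`. -/
def e5 : Cover ℤ := ⟨0, 0, 0, 0, 0, 1, 0, 0, 0, 0⟩
/-- The basis vector `v₆`. -/
def e6 : Cover ℤ := ⟨0, 0, 0, 0, 0, 0, 1, 0, 0, 0⟩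
/-- The basis vector `v₇`. -/
def e7 : Cover ℤ := ⟨0, 0, 0, 0, 0, 0, 0, 1, 0, 0⟩
/-- The basis vector `X`. -/
def eX : Cover ℤ := ⟨0, 0, 0, 0, 0, 0, 0, 0, 1, 0⟩
/-- The basis vector `Y`. -/
def eY : Cover ℤ := ⟨0, 0, 0, 0, 0, 0, 0, 0, 0, 1⟩

theorem lie_eb_ea : ⁅eb, ea⁆ = e2 := by simp [lie_def, ea, eb, e2]
theorem lie_e2_ea : ⁅e2, ea⁆ = e3 := by simp [lie_def, ea, e2, e3]
theorem lie_e3_ea : ⁅e3, ea⁆ = e4 := by simp [lie_def, ea, e3, e4]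
theorem lie_e4_ea : ⁅e4, ea⁆ = e5 := by simp [lie_def, ea, e4, e5]
theorem lie_e5_ea : ⁅e5, ea⁆ = e6 := by simp [lie_def, ea, e5, e6]
theorem lie_e6_ea : ⁅e6, ea⁆ = e7 := by simp [lie_def, ea, e6, e7]
theorem lie_e2_eb : ⁅e2, eb⁆ = e5 + eX := by
  simp [lie_def, add_def, eb, e2, e5, eX]
theorem lie_e4_eb : ⁅e4, eb⁆ = e6 + eY := by
  simp [lie_def, add_def, eb, e4, e6, eY]

theorem eq_sum (g : Cover ℤ) : g = g.a • ea + g.b • eb + g.c2 • e2 + g.c3 • e3 + g.c4 • e4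
    + g.c5 • e5 + g.c6 • e6 + g.c7 • e7 + g.x • eX + g.y • eY := by
  ext <;> simp [zsmul_def, add_def, ea, eb, e2, e3, e4, e5, e6, e7, eX, eY]

theorem eq_top_of_mem (S : LieSubalgebra ℤ (Cover ℤ)) (ha : ea ∈ S) (hb : eb ∈ S) : S = ⊤ := by
  have h2 : e2 ∈ S := lie_eb_ea ▸ S.lie_mem hb ha
  have h3 : e3 ∈ S := lie_e2_ea ▸ S.lie_mem h2 ha
  have h4 : e4 ∈ S := lie_e3_ea ▸ S.lie_mem h3 ha
  have h5 : e5 ∈ S := lie_e4_ea ▸ S.lie_mem h4 ha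
  have h6 : e6 ∈ S := lie_e5_ea ▸ S.lie_mem h5 ha
  have h7 : e7 ∈ S := lie_e6_ea ▸ S.lie_mem h6 ha
  have hX : eX ∈ S := by
    have := S.sub_mem (S.lie_mem h2 hb) h5
    rwa [lie_e2_eb, add_sub_cancel_left] at this
  have hY : eY ∈ S := by
    have := S.sub_mem (S.lie_mem h4 hb) h6
    rwa [lie_e4_eb, add_sub_cancel_left] at this
  refine eq_top_iff.2 fun g _ => ?_
  rw [eq_sum g]
  exact S.add_mem (S.add_mem (S.add_mem (S.add_mem (S.add_mem (S.add_mem (S.add_mem (S.add_mem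
    (S.add_mem (S.smul_mem _ ha) (S.smul_mem _ hb)) (S.smul_mem _ h2)) (S.smul_mem _ h3))
    (S.smul_mem _ h4)) (S.smul_mem _ h5)) (S.smul_mem _ h6)) (S.smul_mem _ h7))
    (S.smul_mem _ hX)) (S.smul_mem _ hY)

theorem hom_ext {L : Type*} [LieRing L] {f g : Cover ℤ →ₗ⁅ℤ⁆ L} (ha : f ea = g ea)
    (hb : f eb = g eb) (u : Cover ℤ) : f u = g u := by
  have h2 : f e2 = g e2 := by simp [← lie_eb_ea, ha, hb]
  have h3 : f e3 = g e3 := by simp [← lie_e2_ea, ha, h2]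
  have h4 : f e4 = g e4 := by simp [← lie_e3_ea, ha, h3]
  have h5 : f e5 = g e5 := by simp [← lie_e4_ea, ha, h4]
  have h6 : f e6 = g e6 := by simp [← lie_e5_ea, ha, h5]
  have h7 : f e7 = g e7 := by simp [← lie_e6_ea, ha, h6]
  have hX : f eX = g eX := by
    have h (k : Cover ℤ →ₗ⁅ℤ⁆ L) : k eX = ⁅k e2, k eb⁆ - k e5 := by
      rw [← LieHom.map_lie, lie_e2_eb, map_add, add_sub_cancel_left]
    rw [h, h, h2, hb, h5]
  have hY : f eY = g eY := by
    have h (k : Cover ℤ →ₗ⁅ℤ⁆ L) : k eY = ⁅k e4, k eb⁆ - k e6 := by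
      rw [← LieHom.map_lie, lie_e4_eb, map_add, add_sub_cancel_left]
    rw [h, h, h4, hb, h6]
  rw [eq_sum u]
  simp only [map_add, map_zsmul, ha, hb, h2, h3, h4, h5, h6, h7, hX, hY]

/-- A Lie ring generated by two elements satisfying the defining relations up to central error
terms is an image of `Cover ℤ`. -/
theorem exists_hom {L : Type*} [LieRing L] {a b v2 v3 v4 v5 v6 v7 X Y : L}
    (h2 : ⁅b, a⁆ = v2) (h3 : ⁅v2, a⁆ = v3) (h4 : ⁅v3, a⁆ = v4) (h5 : ⁅v4, a⁆ = v5)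
    (h6 : ⁅v5, a⁆ = v6) (h7 : ⁅v6, a⁆ = v7) (hX : ⁅v2, b⁆ = v5 + X) (hY : ⁅v4, b⁆ = v6 + Y)
    (cX : ∀ l : L, ⁅X, l⁆ = 0) (cY : ∀ l : L, ⁅Y, l⁆ = 0) (c7 : ∀ l : L, ⁅v7, l⁆ = 0)
    (c6 : ∀ l : L, ⁅⁅v6, b⁆, l⁆ = 0) :
    ∃ φ : Cover ℤ →ₗ⁅ℤ⁆ L, φ ea = a ∧ φ eb = b := by
  have sw (z : L) (h : ∀ l : L, ⁅z, l⁆ = 0) (l : L) : ⁅l, z⁆ = 0 := by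
    rw [← lie_skew, h, neg_zero]
  have J (z m n : L) : ⁅z, ⁅m, n⁆⁆ = ⁅⁅z, m⁆, n⁆ - ⁅⁅z, n⁆, m⁆ := by
    rw [leibniz_lie, ← lie_skew m ⁅z, n⁆]; abel
  have J' (z m n : L) : ⁅⁅z, m⁆, n⁆ = ⁅⁅z, n⁆, m⁆ + ⁅z, ⁅m, n⁆⁆ := by rw [J]; abel
  have h32 : ⁅v3, b⁆ = v6 := by
    rw [← h3, J', hX, add_lie, cX, add_zero, h6, ← lie_skew a b, h2, lie_neg, lie_self]; simp
  have k32 : ⁅v3, v2⁆ = v7 - v6 - Y := by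
    rw [← h2, J, h32, h7, h4, hY]; abel
  have k42 : ⁅v4, v2⁆ = -v7 := by
    rw [← h4, J', k32, sub_lie, sub_lie, c7, cY, h7, ← lie_skew a v2, h3, lie_neg, lie_self]; simp
  have k5b : ⁅v5, b⁆ = v7 + v7 := by
    rw [← h5, J', hY, add_lie, cY, add_zero, h7, ← lie_skew a b, h2, lie_neg, k42, neg_neg]
  have k52 : ⁅v5, v2⁆ = -⁅v6, b⁆ := by
    rw [← h2, J, k5b, h6, add_lie, c7]; simp
  have k62 : ⁅v6, v2⁆ = 0 := by rw [← h2, J, c6, h7, c7]; simp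
  have k53 : ⁅v5, v3⁆ = 0 := by rw [← h3, J, k52, neg_lie, c6, h6, k62]; simp
  have k6b : ⁅v6, b⁆ = 0 := by
    have h := J' v3 v2 b
    rw [k32, h32, hX, sub_lie, sub_lie, c7, cY, k62, lie_add, sw X cX, ← lie_skew v3 v5, k53] at h
    rw [← lie_skew, neg_eq_zero]
    simpa using h
  have k52' : ⁅v5, v2⁆ = 0 := by rw [k52, k6b, neg_zero]
  have k43 : ⁅v4, v3⁆ = 0 := by
    rw [← h3, J, k42, h5, k52', neg_lie, c7]; simp
  have k63 : ⁅v6, v3⁆ = 0 := by rw [← h3, J, k62, h7, c7]; simp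
  have k54 : ⁅v5, v4⁆ = 0 := by rw [← h4, J, k53, h6, k63]; simp
  have k64 : ⁅v6, v4⁆ = 0 := by rw [← h4, J, k63, h7, c7]; simp
  have k65 : ⁅v6, v5⁆ = 0 := by rw [← h5, J, k64, h7, c7]; simp
  have n {z m k : L} (h : ⁅z, m⁆ = k) : ⁅m, z⁆ = -k := by rw [← lie_skew, h]
  let f : Cover ℤ → L := fun g => g.a • a + g.b • b + g.c2 • v2 + g.c3 • v3 + g.c4 • v4
    + g.c5 • v5 + g.c6 • v6 + g.c7 • v7 + g.x • X + g.y • Y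
  let F : Cover ℤ →+ L := AddMonoidHom.mk' f fun u v => by simp only [f, add_def]; module
  refine ⟨{ F.toIntLinearMap with map_lie' := ?_ }, ?_, ?_⟩
  · intro u v
    change f ⁅u, v⁆ = ⁅f u, f v⁆
    simp only [f, lie_def, add_lie, lie_add, zsmul_lie, lie_zsmul, lie_self, cX, cY, c7, sw X cX,
      sw Y cY, sw v7 c7, h2, h3, h4, h5, h6, h7, hX, hY, h32, k32, k42, k5b, k62, k53, k6b, k52',
      k43, k63, k54, k64, k65, n h2, n h3, n h4, n h5, n h6, n h7, n hX, n hY, n h32, n k32, n k42,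
      n k5b, n k62, n k53, n k6b, n k52', n k43, n k63, n k54, n k64, n k65]
    module
  · change f ea = a
    simp [f, ea]
  · change f eb = b
    simp [f, eb]

end Cover

section LowerCentralSeries

open LieModule

variable {L L' : Type*} [LieRing L] [LieRing L']

theorem lie_mem_lcs_succ {k : ℕ} (x : L) {m : L} (hm : m ∈ lowerCentralSeries ℤ L L k) :
    ⁅x, m⁆ ∈ lowerCentralSeries ℤ L L (k + 1) := by
  rw [lowerCentralSeries_succ]
  exact LieSubmodule.lie_mem_lie (LieSubmodule.mem_top x) hm

theorem lie_mem_lcs_succ' {k : ℕ} (x : L) {m : L} (hm : m ∈ lowerCentralSeries ℤ L L k) :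
    ⁅m, x⁆ ∈ lowerCentralSeries ℤ L L (k + 1) := by
  rw [← lie_skew]
  exact neg_mem (lie_mem_lcs_succ x hm)

theorem lcs_succ_induction {k : ℕ} {P : L → Prop} (h0 : P 0) (hadd : ∀ x y, P x → P y → P (x + y))
    (hsmul : ∀ (n : ℤ) x, P x → P (n • x))
    (hlie : ∀ x : L, ∀ m ∈ lowerCentralSeries ℤ L L k, P ⁅x, m⁆) :
    ∀ m ∈ lowerCentralSeries ℤ L L (k + 1), P m := by
  intro m hm
  rw [lowerCentralSeries_succ, ← LieSubmodule.mem_toSubmodule,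
    LieSubmodule.lieIdeal_oper_eq_linear_span'] at hm
  induction hm using Submodule.span_induction with
  | mem x h => obtain ⟨y, -, z, hz, rfl⟩ := h; exact hlie y z hz
  | zero => exact h0
  | add x y _ _ hx hy => exact hadd x y hx hy
  | smul a x _ hx => exact hsmul a x hx

theorem map_mem_lcs (f : L →ₗ⁅ℤ⁆ L') {k : ℕ} :
    ∀ {m : L}, m ∈ lowerCentralSeries ℤ L L k → f m ∈ lowerCentralSeries ℤ L' L' k := by
  induction k with
  | zero => simp
  | succ k ih =>
    intro m hm
    refine lcs_succ_induction (P := fun m => f m ∈ lowerCentralSeries ℤ L' L' (k + 1))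
      ?_ ?_ ?_ ?_ m hm
    · simp
    · intro x y hx hy
      rw [map_add]
      exact add_mem hx hy
    · intro n x hx
      rw [map_zsmul]
      exact zsmul_mem hx n
    · intro x m hm
      rw [LieHom.map_lie]
      exact lie_mem_lcs_succ _ (ih hm)

theorem exists_mem_lcs_of_surjective (f : L →ₗ⁅ℤ⁆ L') (hf : Function.Surjective f) {k : ℕ} :
    ∀ m ∈ lowerCentralSeries ℤ L' L' k, ∃ x ∈ lowerCentralSeries ℤ L L k, f x = m := by
  induction k with
  | zero =>
    intro m _
    obtain ⟨x, rfl⟩ := hf m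
    exact ⟨x, by simp, rfl⟩
  | succ k ih =>
    refine lcs_succ_induction ⟨0, zero_mem _, map_zero f⟩ ?_ ?_ ?_
    · rintro _ _ ⟨x, hx, rfl⟩ ⟨y, hy, rfl⟩
      exact ⟨x + y, add_mem hx hy, map_add f x y⟩
    · rintro n _ ⟨x, hx, rfl⟩
      exact ⟨n • x, zsmul_mem hx n, map_zsmul f n x⟩
    · intro x m hm
      obtain ⟨y, rfl⟩ := hf x
      obtain ⟨z, hz, rfl⟩ := ih m hm
      exact ⟨⁅y, z⁆, lie_mem_lcs_succ y hz, f.map_lie y z⟩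

end LowerCentralSeries

section IsLieIso

variable {α β γ : Type*} [LieRing α] [LieRing β] [LieRing γ]

theorem IsLieIso.refl (α : Type*) [LieRing α] : IsLieIso α α :=
  ⟨Equiv.refl α, fun _ _ => rfl, fun _ _ => rfl⟩

theorem IsLieIso.symm (h : IsLieIso α β) : IsLieIso β α := by
  obtain ⟨e, h1, h2⟩ := h
  exact ⟨e.symm, fun x y => by simp [e.symm_apply_eq, h1],
    fun x y => by simp [e.symm_apply_eq, h2]⟩

theorem IsLieIso.trans (h : IsLieIso α β) (h' : IsLieIso β γ) : IsLieIso α γ := by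
  obtain ⟨e, h1, h2⟩ := h
  obtain ⟨e', h1', h2'⟩ := h'
  exact ⟨e.trans e', fun x y => by simp [h1, h1'], fun x y => by simp [h2, h2']⟩

/-- An additive map preserving brackets, as a homomorphism of Lie algebras over `ℤ`. -/
def intLieHom (f : α → β) (hadd : ∀ x y, f (x + y) = f x + f y)
    (hlie : ∀ x y, f ⁅x, y⁆ = ⁅f x, f y⁆) : α →ₗ⁅ℤ⁆ β :=
  { (AddMonoidHom.mk' f hadd).toIntLinearMap with map_lie' := fun {x y} => hlie x y }

@[simp]
theorem intLieHom_apply (f : α → β) (hadd : ∀ x y, f (x + y) = f x + f y)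
    (hlie : ∀ x y, f ⁅x, y⁆ = ⁅f x, f y⁆) (x : α) : intLieHom f hadd hlie x = f x := rfl

theorem IsLieIso.exists_hom (h : IsLieIso α β) :
    ∃ f : α →ₗ⁅ℤ⁆ β, Function.Bijective f := by
  obtain ⟨e, h1, h2⟩ := h
  exact ⟨intLieHom e h1 h2, e.bijective⟩

theorem isLieIso_of_ker_eq (f : α →ₗ⁅ℤ⁆ β) (g : α →ₗ⁅ℤ⁆ γ) (hf : Function.Surjective f)
    (hg : Function.Surjective g) (h : ∀ x, f x = 0 ↔ g x = 0) : IsLieIso β γ := by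
  have key (x y : α) : f x = f y ↔ g x = g y := by
    rw [← sub_eq_zero, ← map_sub, h, map_sub, sub_eq_zero]
  choose s hs using hf
  have hgs (x : α) : g (s (f x)) = g x := (key _ _).1 (hs _)
  refine ⟨Equiv.ofBijective (fun y => g (s y)) ⟨fun y z hyz => ?_, fun z => ?_⟩, ?_, ?_⟩
  · rw [← hs y, ← hs z]
    exact (key _ _).2 hyz
  · obtain ⟨x, rfl⟩ := hg z
    exact ⟨f x, hgs x⟩
  · intro y z
    change g (s (y + z)) = g (s y) + g (s z)
    rw [← map_add, ← key, map_add, hs, hs, hs]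
  · intro y z
    change g (s ⁅y, z⁆) = ⁅g (s y), g (s z)⁆
    rw [← LieHom.map_lie, ← key, LieHom.map_lie, hs, hs, hs]

/-- The canonical projection onto the quotient by a Lie ideal. -/
def quotHom (I : LieIdeal ℤ α) : α →ₗ⁅ℤ⁆ α ⧸ I :=
  intLieHom (LieSubmodule.Quotient.mk (N := I)) (fun _ _ => rfl)
    (fun x y => LieSubmodule.Quotient.mk_bracket I x y)

theorem quotHom_surjective (I : LieIdeal ℤ α) : Function.Surjective (quotHom I) :=
  Quot.mk_surjective

theorem quotHom_eq_zero (I : LieIdeal ℤ α) (x : α) : quotHom I x = 0 ↔ x ∈ I :=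
  LieSubmodule.Quotient.mk_eq_zero'

/-- A homomorphism vanishing on a Lie ideal factors through the quotient. -/
theorem exists_quot_lift (I : LieIdeal ℤ α) (f : α →ₗ⁅ℤ⁆ β) (h : ∀ x ∈ I, f x = 0) :
    ∃ F : (α ⧸ I) →ₗ⁅ℤ⁆ β, ∀ x, F (quotHom I x) = f x := by
  have hq (x y : α) (hxy : quotHom I x = quotHom I y) : f x = f y := by
    rw [← sub_eq_zero, ← map_sub]
    apply h
    rw [← quotHom_eq_zero, map_sub, hxy, sub_self]
  choose s hs using quotHom_surjective I
  have hfs (x : α) : f (s (quotHom I x)) = f x := hq _ _ (hs _)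
  refine ⟨intLieHom (fun y => f (s y)) ?_ ?_, hfs⟩
  · intro y z
    rw [← map_add]
    exact hq _ _ (by rw [map_add, hs, hs, hs])
  · intro y z
    rw [← LieHom.map_lie]
    exact hq _ _ (by rw [LieHom.map_lie, hs, hs, hs])

end IsLieIso

section FreeLieRing

variable {L : Type*} [LieRing L]

theorem exists_lift_FL (a b : L) : ∃ f : FL →ₗ⁅ℤ⁆ L, f ga = a ∧ f gb = b := by
  let F := FreeLieAlgebra.lift ℤ (L := L) ![a, b]
  refine ⟨intLieHom F (fun x y => map_add F x y) (fun x y => LieHom.map_lie F x y), ?_, ?_⟩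
  · change F ga = a
    simp [F, ga]
  · change F gb = b
    simp [F, gb]

theorem hom_ext_FL {f g : FL →ₗ⁅ℤ⁆ L} (ha : f ga = g ga) (hb : f gb = g gb) (x : FL) :
    f x = g x := by
  let C (k : FL →ₗ⁅ℤ⁆ L) := (FreeLieAlgebra.lift ℤ) (k ∘ FreeLieAlgebra.of ℤ)
  have hC (k : FL →ₗ⁅ℤ⁆ L) (x : FL) : C k x = k x := by
    let K : @LieHom ℤ FL L _ _ (FreeLieAlgebra.instLieAlgebra ℤ _) _ _ :=
      { toFun := k
        map_add' := map_add k
        map_smul' := fun n x => (congrArg k (int_smul_eq_zsmul _ n x)).trans (map_zsmul k n x)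
        map_lie' := k.map_lie _ _ }
    exact DFunLike.congr_fun (FreeLieAlgebra.lift_comp_of K) x
  rw [← hC f, ← hC g]
  have : f ∘ FreeLieAlgebra.of ℤ = g ∘ FreeLieAlgebra.of ℤ := by
    funext i
    fin_cases i
    · exact ha
    · exact hb
  simp only [C, this]

theorem FL_eq_top_of_mem (S : LieSubalgebra ℤ FL) (ha : ga ∈ S) (hb : gb ∈ S) : S = ⊤ := by
  obtain ⟨f, fa, fb⟩ := exists_lift_FL (⟨ga, ha⟩ : S) ⟨gb, hb⟩
  refine eq_top_iff.2 fun x _ => ?_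
  have : S.incl (f x) = x :=
    hom_ext_FL (f := S.incl.comp f) (g := LieHom.id) (by simp [fa]) (by simp [fb]) x
  rw [← this]
  exact (f x).2

end FreeLieRing

open LieModule in
theorem Cover.coeff_of_mem_lcs :
    (∀ g ∈ lowerCentralSeries ℤ (Cover ℤ) (Cover ℤ) 6, g.a = 0 ∧ g.b = 0 ∧ g.c2 = 0 ∧ g.c3 = 0 ∧
      g.c4 = 0 ∧ g.c5 = 0 ∧ g.c6 = 0 ∧ g.x = 0 ∧ g.y = 0) ∧
    ∀ g ∈ lowerCentralSeries ℤ (Cover ℤ) (Cover ℤ) 7, g = 0 := by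
  have h1 : ∀ g ∈ lowerCentralSeries ℤ (Cover ℤ) (Cover ℤ) 1, g.a = 0 ∧ g.b = 0 := by
    refine lcs_succ_induction ?_ ?_ ?_ ?_ <;>
      simp +contextual [Cover.zero_def, Cover.add_def, Cover.zsmul_def, Cover.lie_def]
  have h2 : ∀ g ∈ lowerCentralSeries ℤ (Cover ℤ) (Cover ℤ) 2, g.a = 0 ∧ g.b = 0 ∧ g.c2 = 0 := by
    refine lcs_succ_induction ?_ ?_ ?_ fun x m hm => ?_
    iterate 3 simp +contextual [Cover.zero_def, Cover.add_def, Cover.zsmul_def]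
    simp [Cover.lie_def, h1 m hm]
  have h3 : ∀ g ∈ lowerCentralSeries ℤ (Cover ℤ) (Cover ℤ) 3, g.a = 0 ∧ g.b = 0 ∧ g.c2 = 0 ∧
      g.c3 = 0 ∧ g.x = 0 := by
    refine lcs_succ_induction ?_ ?_ ?_ fun x m hm => ?_
    iterate 3 simp +contextual [Cover.zero_def, Cover.add_def, Cover.zsmul_def]
    simp [Cover.lie_def, h2 m hm]
  have h4 : ∀ g ∈ lowerCentralSeries ℤ (Cover ℤ) (Cover ℤ) 4, g.a = 0 ∧ g.b = 0 ∧ g.c2 = 0 ∧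
      g.c3 = 0 ∧ g.c4 = 0 ∧ g.x = 0 := by
    refine lcs_succ_induction ?_ ?_ ?_ fun x m hm => ?_
    iterate 3 simp +contextual [Cover.zero_def, Cover.add_def, Cover.zsmul_def]
    simp [Cover.lie_def, h3 m hm]
  have h5 : ∀ g ∈ lowerCentralSeries ℤ (Cover ℤ) (Cover ℤ) 5, g.a = 0 ∧ g.b = 0 ∧ g.c2 = 0 ∧
      g.c3 = 0 ∧ g.c4 = 0 ∧ g.c5 = 0 ∧ g.x = 0 ∧ g.y = 0 := by
    refine lcs_succ_induction ?_ ?_ ?_ fun x m hm => ?_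
    iterate 3 simp +contextual [Cover.zero_def, Cover.add_def, Cover.zsmul_def]
    simp [Cover.lie_def, h4 m hm]
  have h6 : ∀ g ∈ lowerCentralSeries ℤ (Cover ℤ) (Cover ℤ) 6, g.a = 0 ∧ g.b = 0 ∧ g.c2 = 0 ∧
      g.c3 = 0 ∧ g.c4 = 0 ∧ g.c5 = 0 ∧ g.c6 = 0 ∧ g.x = 0 ∧ g.y = 0 := by
    refine lcs_succ_induction ?_ ?_ ?_ fun x m hm => ?_
    iterate 3 simp +contextual [Cover.zero_def, Cover.add_def, Cover.zsmul_def]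
    simp [Cover.lie_def, h5 m hm]
  refine ⟨h6, lcs_succ_induction ?_ ?_ ?_ fun x m hm => ?_⟩
  iterate 3 simp +contextual
  simp [Cover.lie_def, Cover.zero_def, h6 m hm]

theorem Cover.e7_mem_lcs : e7 ∈ LieModule.lowerCentralSeries ℤ (Cover ℤ) (Cover ℤ) 6 := by
  rw [← lie_e6_ea, ← lie_e5_ea, ← lie_e4_ea, ← lie_e3_ea, ← lie_e2_ea, ← lie_eb_ea]
  iterate 6 apply lie_mem_lcs_succ'
  simp

/-- The ideal of `Cover ℤ` presenting `M`: all coefficients up to weight six vanish modulo `p`. -/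
def topIdeal (p : ℕ) : LieIdeal ℤ (Cover ℤ) where
  carrier := {g | (p : ℤ) ∣ g.a ∧ (p : ℤ) ∣ g.b ∧ (p : ℤ) ∣ g.c2 ∧ (p : ℤ) ∣ g.c3 ∧
    (p : ℤ) ∣ g.c4 ∧ (p : ℤ) ∣ g.c5 ∧ (p : ℤ) ∣ g.c6}
  zero_mem' := by simp [Cover.zero_def]
  add_mem' := by
    rintro u v ⟨_, _, _, _, _, _, _⟩ ⟨_, _, _, _, _, _, _⟩
    refine ⟨?_, ?_, ?_, ?_, ?_, ?_, ?_⟩ <;> simp only [Cover.add_def] <;>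
      apply dvd_add <;> assumption
  smul_mem' := by
    rintro n u ⟨_, _, _, _, _, _, _⟩
    refine ⟨?_, ?_, ?_, ?_, ?_, ?_, ?_⟩ <;> simp only [Cover.zsmul_def] <;>
      apply dvd_mul_of_dvd_right <;> assumption
  lie_mem := by
    rintro u m ⟨⟨ka, ha⟩, ⟨kb, hb⟩, ⟨k2, h2⟩, ⟨k3, h3⟩, ⟨k4, h4⟩, ⟨k5, h5⟩, ⟨k6, h6⟩⟩
    refine ⟨dvd_zero _, dvd_zero _,
      ⟨u.b * ka - u.a * kb, ?_⟩,
      ⟨u.c2 * ka - u.a * k2, ?_⟩,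
      ⟨u.c3 * ka - u.a * k3, ?_⟩,
      ⟨u.c4 * ka - u.a * k4 + (u.c2 * kb - u.b * k2), ?_⟩,
      ⟨u.c5 * ka - u.a * k5 + (u.c3 * kb - u.b * k3) + (u.c4 * kb - u.b * k4)
        - (u.c3 * k2 - u.c2 * k3), ?_⟩⟩ <;>
      simp only [Cover.lie_def, ha, hb, h2, h3, h4, h5, h6] <;> ring

theorem mem_topIdeal {p : ℕ} {g : Cover ℤ} : g ∈ topIdeal p ↔ (p : ℤ) ∣ g.a ∧ (p : ℤ) ∣ g.b ∧
    (p : ℤ) ∣ g.c2 ∧ (p : ℤ) ∣ g.c3 ∧ (p : ℤ) ∣ g.c4 ∧ (p : ℤ) ∣ g.c5 ∧ (p : ℤ) ∣ g.c6 := Iff.rfl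

/-- The ideal of `Cover ℤ` generated by `X`, `Y`, `p • vᵢ`, `p • a - s • v₇` and
`p • b - t • v₇`. -/
def relIdeal (p : ℕ) (s t : ZMod p) : LieIdeal ℤ (Cover ℤ) where
  carrier := {g | ∃ i j : ℤ, g.a = p * i ∧ g.b = p * j ∧ (p : ℤ) ∣ g.c2 ∧ (p : ℤ) ∣ g.c3 ∧
    (p : ℤ) ∣ g.c4 ∧ (p : ℤ) ∣ g.c5 ∧ (p : ℤ) ∣ g.c6 ∧ (g.c7 : ZMod p) + s * i + t * j = 0}
  zero_mem' := ⟨0, 0, by simp [Cover.zero_def]⟩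
  add_mem' := by
    rintro u v ⟨i, j, _, _, _, _, _, _, _, h⟩ ⟨i', j', _, _, _, _, _, _, _, h'⟩
    refine ⟨i + i', j + j', ?_, ?_, ?_, ?_, ?_, ?_, ?_, ?_⟩ <;> simp only [Cover.add_def]
    · simp only [*]; ring
    · simp only [*]; ring
    iterate 5 apply dvd_add <;> assumption
    push_cast
    linear_combination h + h'
  smul_mem' := by
    rintro n u ⟨i, j, _, _, _, _, _, _, _, h⟩
    refine ⟨n * i, n * j, ?_, ?_, ?_, ?_, ?_, ?_, ?_, ?_⟩ <;> simp only [Cover.zsmul_def]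
    · simp only [Int.cast_id, *]; ring
    · simp only [Int.cast_id, *]; ring
    iterate 5 apply dvd_mul_of_dvd_right; assumption
    push_cast
    linear_combination (n : ZMod p) * h
  lie_mem := by
    rintro u m ⟨i, j, ha, hb, h2, h3, h4, h5, h6, -⟩
    obtain ⟨-, -, h2', h3', h4', h5', h6'⟩ := (topIdeal p).lie_mem (x := u) (m := m)
      ⟨⟨i, ha⟩, ⟨j, hb⟩, h2, h3, h4, h5, h6⟩
    refine ⟨0, 0, by simp [Cover.lie_def], by simp [Cover.lie_def], h2', h3', h4', h5', h6', ?_⟩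
    obtain ⟨k2, h2⟩ := h2
    obtain ⟨k3, h3⟩ := h3
    obtain ⟨k4, h4⟩ := h4
    obtain ⟨k5, h5⟩ := h5
    obtain ⟨k6, h6⟩ := h6
    simp [Cover.lie_def, ha, hb, h2, h3, h4, h5, h6]

theorem mem_relIdeal {p : ℕ} {s t : ZMod p} {g : Cover ℤ} : g ∈ relIdeal p s t ↔
    ∃ i j : ℤ, g.a = p * i ∧ g.b = p * j ∧ (p : ℤ) ∣ g.c2 ∧ (p : ℤ) ∣ g.c3 ∧ (p : ℤ) ∣ g.c4 ∧
      (p : ℤ) ∣ g.c5 ∧ (p : ℤ) ∣ g.c6 ∧ (g.c7 : ZMod p) + s * i + t * j = 0 := Iff.rfl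

theorem relIdeal_le_topIdeal {p : ℕ} {s t : ZMod p} : relIdeal p s t ≤ topIdeal p := by
  rintro g ⟨i, j, ha, hb, h2, h3, h4, h5, h6, -⟩
  exact ⟨⟨i, ha⟩, ⟨j, hb⟩, h2, h3, h4, h5, h6⟩

/-- A complete invariant of the cosets of `relIdeal p s t`. -/
def cosetInvariant (p : ℕ) (s t : ZMod p) (g : Cover ℤ) : Fin 8 → ZMod p :=
  ![g.a, g.b, g.c2, g.c3, g.c4, g.c5, g.c6, g.c7 + s * (g.a / p : ℤ) + t * (g.b / p : ℤ)]

theorem cosetInvariant_surjective (p : ℕ) [NeZero p] (s t : ZMod p) :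
    Function.Surjective (cosetInvariant p s t) := by
  intro f
  obtain ⟨l, hl⟩ : ∃ l : ZMod p → ℤ, ∀ z, (l z : ZMod p) = z :=
    ⟨fun z => z.val, fun z => by simp⟩
  refine ⟨⟨l (f 0), l (f 1), l (f 2), l (f 3), l (f 4), l (f 5), l (f 6),
    l (f 7 - s * (l (f 0) / p : ℤ) - t * (l (f 1) / p : ℤ)), 0, 0⟩, ?_⟩
  ext i
  fin_cases i
  iterate 7 simp [cosetInvariant, hl]
  simp only [cosetInvariant, hl]
  simp
  ring

theorem cosetInvariant_eq_iff {p : ℕ} [NeZero p] {s t : ZMod p} {u v : Cover ℤ} :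
    cosetInvariant p s t u = cosetInvariant p s t v ↔ u - v ∈ relIdeal p s t := by
  have hp : (p : ℤ) ≠ 0 := by exact_mod_cast NeZero.ne p
  have hd (m n : ℤ) : (m : ZMod p) = n ↔ (p : ℤ) ∣ m - n := by
    rw [← ZMod.intCast_zmod_eq_zero_iff_dvd, Int.cast_sub, sub_eq_zero]
  have hq {m n i : ℤ} (h : m - n = p * i) : m / p = n / p + i := by
    rw [← Int.add_mul_ediv_left _ _ hp]
    congr 1
    linarith
  simp only [cosetInvariant, funext_iff, Fin.forall_fin_succ, mem_relIdeal, Cover.sub_def]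
  simp only [Matrix.cons_val_zero, Matrix.cons_val_succ, hd]
  constructor
  · rintro ⟨⟨i, hi⟩, ⟨j, hj⟩, h2, h3, h4, h5, h6, h7, -⟩
    refine ⟨i, j, hi, hj, h2, h3, h4, h5, h6, ?_⟩
    rw [hq hi, hq hj] at h7
    push_cast at h7 ⊢
    linear_combination h7
  · rintro ⟨i, j, hi, hj, h2, h3, h4, h5, h6, h7⟩
    refine ⟨⟨i, hi⟩, ⟨j, hj⟩, h2, h3, h4, h5, h6, ?_, by simp⟩
    rw [hq hi, hq hj]
    push_cast at h7 ⊢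
    linear_combination h7

theorem natCard_quot_relIdeal (p : ℕ) [NeZero p] (s t : ZMod p) :
    Nat.card (Cover ℤ ⧸ relIdeal p s t) = p ^ 8 := by
  have key (u v : Cover ℤ) : quotHom (relIdeal p s t) u = quotHom (relIdeal p s t) v ↔
      cosetInvariant p s t u = cosetInvariant p s t v := by
    rw [cosetInvariant_eq_iff, ← quotHom_eq_zero, map_sub, sub_eq_zero]
  choose σ hσ using quotHom_surjective (relIdeal p s t)
  have hb : Function.Bijective fun y => cosetInvariant p s t (σ y) := by
    constructor
    · intro y z h
      rw [← hσ y, ← hσ z]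
      exact (key _ _).2 h
    · intro f
      obtain ⟨g, rfl⟩ := cosetInvariant_surjective p s t f
      exact ⟨quotHom _ g, (key _ _).1 (hσ _)⟩
  rw [Nat.card_congr (Equiv.ofBijective _ hb)]
  simp

theorem map_eq_zero_of_mem_topIdeal {p : ℕ} {L : Type*} [LieRing L] (φ : Cover ℤ →ₗ⁅ℤ⁆ L)
    (ha : p • φ Cover.ea = 0) (hb : p • φ Cover.eb = 0) (h7 : φ Cover.e7 = 0)
    (hX : φ Cover.eX = 0) (hY : φ Cover.eY = 0) {g : Cover ℤ} (hg : g ∈ topIdeal p) :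
    φ g = 0 := by
  have ml {u v : Cover ℤ} (h : p • φ u = 0) : p • φ ⁅u, v⁆ = 0 := by
    rw [LieHom.map_lie, ← natCast_zsmul, ← zsmul_lie, natCast_zsmul, h, zero_lie]
  have h2 : p • φ Cover.e2 = 0 := by rw [← Cover.lie_eb_ea]; exact ml hb
  have h3 : p • φ Cover.e3 = 0 := by rw [← Cover.lie_e2_ea]; exact ml h2
  have h4 : p • φ Cover.e4 = 0 := by rw [← Cover.lie_e3_ea]; exact ml h3
  have h5 : p • φ Cover.e5 = 0 := by rw [← Cover.lie_e4_ea]; exact ml h4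
  have h6 : p • φ Cover.e6 = 0 := by rw [← Cover.lie_e5_ea]; exact ml h5
  obtain ⟨⟨ka, ea⟩, ⟨kb, eb⟩, ⟨k2, e2⟩, ⟨k3, e3⟩, ⟨k4, e4⟩, ⟨k5, e5⟩, ⟨k6, e6⟩⟩ := hg
  rw [Cover.eq_sum g]
  simp only [ea, eb, e2, e3, e4, e5, e6, mul_comm (p : ℤ), mul_smul]
  simp only [map_add, map_zsmul]
  simp only [natCast_zsmul, ha, hb, h2, h3, h4, h5, h6, h7, hX, hY, smul_zero, add_zero]

theorem exists_hom_presLie (p : ℕ) :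
    ∃ φ : Cover ℤ →ₗ⁅ℤ⁆ presLie p {bab - ba4, ba3b - ba5}, Function.Surjective φ ∧
      ∀ g, φ g = 0 ↔ g ∈ topIdeal p := by
  set I : LieIdeal ℤ FL := LieSubmodule.lieSpan ℤ FL
    (({bab - ba4, ba3b - ba5} : Set FL) ∪ {p • ga, p • gb}) ⊔
      LieModule.lowerCentralSeries ℤ FL FL 6 with hI
  let q := quotHom I
  have hrel {x : FL} (h : x ∈ ({bab - ba4, ba3b - ba5} : Set FL) ∪ {p • ga, p • gb}) :
      q x = 0 := by
    refine (quotHom_eq_zero I x).2 ?_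
    exact (le_sup_left : _ ≤ I) (LieSubmodule.subset_lieSpan h)
  have hlcs {x : FL} (h : x ∈ LieModule.lowerCentralSeries ℤ FL FL 6) : q x = 0 :=
    (quotHom_eq_zero I x).2 ((le_sup_right : _ ≤ I) h)
  have h5 : ba5 ∈ LieModule.lowerCentralSeries ℤ FL FL 5 := by
    unfold ba5 ba4 ba3
    iterate 5 apply lie_mem_lcs_succ'
    simp
  have r1 : q bab = q ba4 := by
    rw [← sub_eq_zero, ← map_sub]
    exact hrel (by simp)
  have r2 : q ba3b = q ba5 := by
    rw [← sub_eq_zero, ← map_sub]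
    exact hrel (by simp)
  obtain ⟨φ, φa, φb⟩ := Cover.exists_hom (L := FL ⧸ I) (a := q ga) (b := q gb)
    (v2 := q ⁅gb, ga⁆) (v3 := q ⁅⁅gb, ga⁆, ga⁆) (v4 := q ba3) (v5 := q ba4) (v6 := q ba5)
    (v7 := 0) (X := 0) (Y := 0) (q.map_lie _ _).symm (q.map_lie _ _).symm (q.map_lie _ _).symm
    (q.map_lie _ _).symm (q.map_lie _ _).symm
    (by rw [← LieHom.map_lie]; exact hlcs (lie_mem_lcs_succ' _ h5))
    (by rw [← LieHom.map_lie, add_zero]; exact r1)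
    (by rw [← LieHom.map_lie, add_zero]; exact r2)
    zero_lie zero_lie zero_lie
    (fun l => by rw [← LieHom.map_lie, hlcs (lie_mem_lcs_succ' _ h5), zero_lie])
  have v2 : φ Cover.e2 = q ⁅gb, ga⁆ := by
    rw [← Cover.lie_eb_ea, LieHom.map_lie, φa, φb, ← LieHom.map_lie]
  have v3 : φ Cover.e3 = q ⁅⁅gb, ga⁆, ga⁆ := by
    rw [← Cover.lie_e2_ea, LieHom.map_lie, φa, v2, ← LieHom.map_lie]
  have v4 : φ Cover.e4 = q ba3 := by
    rw [← Cover.lie_e3_ea, LieHom.map_lie, φa, v3, ← LieHom.map_lie]; rfl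
  have v5 : φ Cover.e5 = q ba4 := by
    rw [← Cover.lie_e4_ea, LieHom.map_lie, φa, v4, ← LieHom.map_lie]; rfl
  have v6 : φ Cover.e6 = q ba5 := by
    rw [← Cover.lie_e5_ea, LieHom.map_lie, φa, v5, ← LieHom.map_lie]; rfl
  have v7 : φ Cover.e7 = 0 := by
    rw [← Cover.lie_e6_ea, LieHom.map_lie, φa, v6, ← LieHom.map_lie]
    exact hlcs (lie_mem_lcs_succ' _ h5)
  have vX : φ Cover.eX = 0 := by
    have h : φ ⁅Cover.e2, Cover.eb⁆ = q ba4 := by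
      rw [LieHom.map_lie, v2, φb, ← LieHom.map_lie]; exact r1
    rwa [Cover.lie_e2_eb, map_add, v5, add_eq_left] at h
  have vY : φ Cover.eY = 0 := by
    have h : φ ⁅Cover.e4, Cover.eb⁆ = q ba5 := by
      rw [LieHom.map_lie, v4, φb, ← LieHom.map_lie]; exact r2
    rwa [Cover.lie_e4_eb, map_add, v6, add_eq_left] at h
  refine ⟨φ, ?_, fun g => ⟨fun hg => ?_, ?_⟩⟩
  · intro y
    obtain ⟨x, rfl⟩ := quotHom_surjective I y
    have h := FL_eq_top_of_mem (φ.range.comap q) ⟨Cover.ea, φa⟩ ⟨Cover.eb, φb⟩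
    exact (h ▸ LieSubalgebra.mem_top x : x ∈ φ.range.comap q)
  · let π := quotHom (topIdeal p)
    have hπ (u : Cover ℤ) : π u = 0 ↔ u ∈ topIdeal p := quotHom_eq_zero _ u
    obtain ⟨ψ, ψa, ψb⟩ := exists_lift_FL (π Cover.ea) (π Cover.eb)
    have hψ : I ≤ ψ.ker := by
      refine sup_le (LieSubmodule.lieSpan_le.2 ?_) ?_
      · rintro x ((rfl | rfl) | (rfl | rfl))
        · change ψ _ = 0
          simp only [bab, ba4, ba3, map_sub, LieHom.map_lie, ψa, ψb]
          simp only [← LieHom.map_lie, ← map_sub]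
          rw [hπ]
          simp [mem_topIdeal, Cover.lie_def, Cover.sub_def, Cover.ea, Cover.eb]
        · change ψ _ = 0
          simp only [ba3b, ba5, ba4, ba3, map_sub, LieHom.map_lie, ψa, ψb]
          simp only [← LieHom.map_lie, ← map_sub]
          rw [hπ]
          simp [mem_topIdeal, Cover.lie_def, Cover.sub_def, Cover.ea, Cover.eb]
        · change ψ _ = 0
          rw [map_nsmul, ψa, ← map_nsmul, hπ]
          simp [mem_topIdeal, Cover.nsmul_def, Cover.ea]
        · change ψ _ = 0
          rw [map_nsmul, ψb, ← map_nsmul, hπ]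
          simp [mem_topIdeal, Cover.nsmul_def, Cover.eb]
      · intro x hx
        obtain ⟨g, hg, hgx⟩ := exists_mem_lcs_of_surjective π (quotHom_surjective _) _
          (map_mem_lcs ψ hx)
        change ψ x = 0
        rw [← hgx, hπ, mem_topIdeal]
        simp [Cover.coeff_of_mem_lcs.1 g hg]
    obtain ⟨Ψ, hΨ⟩ := exists_quot_lift I ψ fun x hx => hψ hx
    have := Cover.hom_ext (f := Ψ.comp φ) (g := π) (by simp [φa, q, hΨ, ψa])
      (by simp [φb, q, hΨ, ψb]) g
    rw [← hπ, ← this, LieHom.comp_apply, hg, map_zero]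
  · refine map_eq_zero_of_mem_topIdeal φ ?_ ?_ v7 vX vY
    · rw [φa, ← map_nsmul]
      exact hrel (by simp)
    · rw [φb, ← map_nsmul]
      exact hrel (by simp)

section Extraction

open LieModule

variable {L : Type*} [LieRing L]

theorem lie_eq_zero_of_mem_lcs {k : ℕ} (h : lowerCentralSeries ℤ L L (k + 1) = ⊥) {x : L}
    (hx : x ∈ lowerCentralSeries ℤ L L k) (l : L) : ⁅x, l⁆ = 0 := by
  have h' := lie_mem_lcs_succ' l hx
  rwa [h, LieSubmodule.mem_bot] at h'

theorem lieClassEq_of_ker_eq_relIdeal {p : ℕ} [Fact p.Prime] {s t : ZMod p} (φ : Cover ℤ →ₗ⁅ℤ⁆ L)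
    (hφ : Function.Surjective φ) (hker : ∀ g, φ g = 0 ↔ g ∈ relIdeal p s t) :
    LieClassEq L 7 := by
  constructor
  · rw [eq_bot_iff]
    intro m hm
    obtain ⟨g, hg, rfl⟩ := exists_mem_lcs_of_surjective φ hφ m hm
    rw [Cover.coeff_of_mem_lcs.2 g hg, map_zero]
    exact zero_mem _
  · intro h
    have h7 : φ Cover.e7 = 0 := by
      have h' := map_mem_lcs φ Cover.e7_mem_lcs
      rwa [h, LieSubmodule.mem_bot] at h'
    obtain ⟨i, j, hi, hj, -, -, -, -, -, h⟩ := (hker _).1 h7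
    have hp : p ≠ 0 := (Fact.out : p.Prime).ne_zero
    have hi : i = 0 := by simpa [Cover.e7, hp] using hi
    have hj : j = 0 := by simpa [Cover.e7, hp] using hj
    simp [Cover.e7, hi, hj] at h

theorem quot_isLieIso_of_ker_eq_relIdeal {p : ℕ} [Fact p.Prime] {s t : ZMod p}
    (φ : Cover ℤ →ₗ⁅ℤ⁆ L) (hφ : Function.Surjective φ)
    (hker : ∀ g, φ g = 0 ↔ g ∈ relIdeal p s t) :
    IsLieIso (L ⧸ lowerCentralSeries ℤ L L 6) (presLie p {bab - ba4, ba3b - ba5}) := by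
  obtain ⟨κ, hκ, hκker⟩ := exists_hom_presLie p
  refine isLieIso_of_ker_eq ((quotHom _).comp φ) κ ((quotHom_surjective _).comp hφ) hκ fun g => ?_
  rw [hκker, LieHom.comp_apply, quotHom_eq_zero]
  constructor
  · intro hg
    obtain ⟨h, hh, hgh⟩ := exists_mem_lcs_of_surjective φ hφ _ hg
    have h1 : g - h ∈ topIdeal p :=
      relIdeal_le_topIdeal ((hker _).1 (by rw [map_sub, hgh, sub_self]))
    have h2 : h ∈ topIdeal p := by
      rw [mem_topIdeal]
      simp [Cover.coeff_of_mem_lcs.1 h hh]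
    simpa using add_mem h1 h2
  · rintro ⟨⟨i, hi⟩, ⟨j, hj⟩, h2, h3, h4, h5, h6⟩
    obtain ⟨c, hc⟩ :=
      ZMod.intCast_surjective ((g.c7 : ZMod p) + s * (i : ZMod p) + t * (j : ZMod p))
    have h : g - c • Cover.e7 ∈ relIdeal p s t := by
      refine mem_relIdeal.2 ⟨i, j, ?_⟩
      simp only [Cover.sub_def, Cover.zsmul_def, Cover.e7, mul_zero, sub_zero, mul_one]
      refine ⟨hi, hj, h2, h3, h4, h5, h6, ?_⟩
      push_cast
      rw [hc]
      ring
    have h' : φ g = c • φ Cover.e7 := by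
      rw [← map_zsmul, ← sub_eq_zero, ← map_sub]
      exact (hker _).2 h
    rw [h']
    exact (lowerCentralSeries ℤ L L 6).smul_mem c (map_mem_lcs φ Cover.e7_mem_lcs)

/-- A central extension of `M` by `L⁷` is an image of `Cover ℤ`. -/
theorem exists_hom_of_quot_isLieIso {p : ℕ} (h7 : lowerCentralSeries ℤ L L 7 = ⊥)
    (hL : IsLieIso (L ⧸ lowerCentralSeries ℤ L L 6) (presLie p {bab - ba4, ba3b - ba5})) :
    ∃ φ : Cover ℤ →ₗ⁅ℤ⁆ L, Function.Surjective φ ∧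
      ∀ g ∈ topIdeal p, φ g ∈ lowerCentralSeries ℤ L L 6 := by
  obtain ⟨κ, hκ, hκker⟩ := exists_hom_presLie p
  obtain ⟨F, hF⟩ := hL.exists_hom
  let π := F.comp (quotHom (lowerCentralSeries ℤ L L 6))
  have hπ : Function.Surjective π := hF.2.comp (quotHom_surjective _)
  have hπker (x : L) : π x = 0 ↔ x ∈ lowerCentralSeries ℤ L L 6 := by
    rw [← quotHom_eq_zero, LieHom.comp_apply, map_eq_zero_iff F hF.1]
  have central {x : L} (hx : x ∈ lowerCentralSeries ℤ L L 6) (l : L) : ⁅x, l⁆ = 0 :=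
    lie_eq_zero_of_mem_lcs h7 hx l
  have kz {g : Cover ℤ} (hg : g ∈ topIdeal p) : κ g = 0 := (hκker g).2 hg
  obtain ⟨a, ha⟩ := hπ (κ Cover.ea)
  obtain ⟨b, hb⟩ := hπ (κ Cover.eb)
  have p2 : π ⁅b, a⁆ = κ Cover.e2 := by
    rw [LieHom.map_lie, ha, hb, ← LieHom.map_lie, Cover.lie_eb_ea]
  have p3 : π ⁅⁅b, a⁆, a⁆ = κ Cover.e3 := by
    rw [LieHom.map_lie, ha, p2, ← LieHom.map_lie, Cover.lie_e2_ea]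
  have p4 : π ⁅⁅⁅b, a⁆, a⁆, a⁆ = κ Cover.e4 := by
    rw [LieHom.map_lie, ha, p3, ← LieHom.map_lie, Cover.lie_e3_ea]
  have p5 : π ⁅⁅⁅⁅b, a⁆, a⁆, a⁆, a⁆ = κ Cover.e5 := by
    rw [LieHom.map_lie, ha, p4, ← LieHom.map_lie, Cover.lie_e4_ea]
  have p6 : π ⁅⁅⁅⁅⁅b, a⁆, a⁆, a⁆, a⁆, a⁆ = κ Cover.e6 := by
    rw [LieHom.map_lie, ha, p5, ← LieHom.map_lie, Cover.lie_e5_ea]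
  have m6 : ⁅⁅⁅⁅⁅b, a⁆, a⁆, a⁆, a⁆, a⁆ ∈ lowerCentralSeries ℤ L L 5 := by
    iterate 5 apply lie_mem_lcs_succ'
    simp
  obtain ⟨φ, φa, φb⟩ := Cover.exists_hom (L := L) (a := a) (b := b) rfl rfl rfl rfl rfl rfl
    (X := ⁅⁅b, a⁆, b⁆ - ⁅⁅⁅⁅b, a⁆, a⁆, a⁆, a⁆)
    (Y := ⁅⁅⁅⁅b, a⁆, a⁆, a⁆, b⁆ - ⁅⁅⁅⁅⁅b, a⁆, a⁆, a⁆, a⁆, a⁆)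
    (by abel) (by abel)
    (central <| (hπker _).1 <| by
      rw [map_sub, p5, LieHom.map_lie, p2, hb, ← LieHom.map_lie, Cover.lie_e2_eb, map_add,
        add_sub_cancel_left]
      exact kz (by simp [mem_topIdeal, Cover.eX]))
    (central <| (hπker _).1 <| by
      rw [map_sub, p6, LieHom.map_lie, p4, hb, ← LieHom.map_lie, Cover.lie_e4_eb, map_add,
        add_sub_cancel_left]
      exact kz (by simp [mem_topIdeal, Cover.eY]))
    (central (lie_mem_lcs_succ' a m6)) (central (lie_mem_lcs_succ' b m6))
  have hπφ (g : Cover ℤ) : π (φ g) = κ g :=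
    Cover.hom_ext (f := π.comp φ) (g := κ) (by simp [φa, ha]) (by simp [φb, hb]) g
  refine ⟨φ, ?_, fun g hg => by rw [← hπker, hπφ, kz hg]⟩
  have dec (x : L) : ∃ g, x - φ g ∈ lowerCentralSeries ℤ L L 6 := by
    obtain ⟨g, hg⟩ := hκ (π x)
    exact ⟨g, by rw [← hπker, map_sub, hπφ, hg, sub_self]⟩
  have hd : ∀ x ∈ lowerCentralSeries ℤ L L 6, x ∈ φ.range := by
    refine lcs_succ_induction (zero_mem _) (fun x y => add_mem)
      (fun n x hx => φ.range.smul_mem n hx) fun x m _ => ?_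
    obtain ⟨g, hg⟩ := dec x
    obtain ⟨h, hh⟩ := dec m
    refine ⟨⁅g, h⁆, ?_⟩
    have h1 := central hg m
    have h2 := central hh (φ g)
    rw [sub_lie, sub_eq_zero] at h1 h2
    change φ ⁅g, h⁆ = _
    rw [h1, LieHom.map_lie, ← lie_skew, ← h2, lie_skew]
  intro x
  obtain ⟨g, hg⟩ := dec x
  obtain ⟨h, hh⟩ := hd _ hg
  change φ h = _ at hh
  exact ⟨g + h, by rw [map_add, hh]; abel⟩

end Extraction

section Normalization

open LieModule Cover

variable {L : Type*} [LieRing L]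

theorem exists_hom_ker_eq_relIdeal {p : ℕ} [Fact p.Prime] (h5 : 5 ≤ p)
    (hcard : Nat.card L = p ^ 8) (h7 : lowerCentralSeries ℤ L L 7 = ⊥)
    (hL : IsLieIso (L ⧸ lowerCentralSeries ℤ L L 6) (presLie p {bab - ba4, ba3b - ba5})) :
    ∃ (s t : ZMod p) (φ : Cover ℤ →ₗ⁅ℤ⁆ L), Function.Surjective φ ∧
      ∀ g, φ g = 0 ↔ g ∈ relIdeal p s t := by
  have hp : p.Prime := Fact.out
  obtain ⟨φ, hφ, hφ6⟩ := exists_hom_of_quot_isLieIso h7 hL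
  have central {x : L} (hx : x ∈ lowerCentralSeries ℤ L L 6) (l : L) : ⁅x, l⁆ = 0 :=
    lie_eq_zero_of_mem_lcs h7 hx l
  have e7mul {x : L} (hx : x ∈ lowerCentralSeries ℤ L L 6) : ∃ n : ℤ, x = n • φ e7 := by
    obtain ⟨g, hg, rfl⟩ := exists_mem_lcs_of_surjective φ hφ _ hx
    refine ⟨g.c7, ?_⟩
    have := Cover.coeff_of_mem_lcs.1 g hg
    conv_lhs => rw [Cover.eq_sum g]
    simp only [this, zero_smul, zero_add, add_zero, map_zsmul]
  have ptop (u : Cover ℤ) : (p : ℤ) • u ∈ topIdeal p :=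
    ⟨Dvd.intro _ rfl, Dvd.intro _ rfl, Dvd.intro _ rfl, Dvd.intro _ rfl, Dvd.intro _ rfl,
      Dvd.intro _ rfl, Dvd.intro _ rfl⟩
  have pl {u v : Cover ℤ} (h : φ ((p : ℤ) • u) ∈ lowerCentralSeries ℤ L L 6) :
      φ ((p : ℤ) • ⁅u, v⁆) = 0 := by
    rw [← zsmul_lie, LieHom.map_lie]
    exact central h _
  have pc {u v : Cover ℤ} : φ ((p : ℤ) • ⁅u, v⁆) = 0 :=
    pl <| hφ6 _ <| ptop u
  have p7 : φ ((p : ℤ) • e7) = 0 := lie_e6_ea ▸ pc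
  obtain ⟨x, hx⟩ := e7mul (hφ6 eX (by simp [mem_topIdeal, eX]))
  obtain ⟨y, hy⟩ := e7mul (hφ6 eY (by simp [mem_topIdeal, eY]))
  have solve {n : ℤ} (hn : IsCoprime n p) (z : ℤ) : ∃ w k : ℤ, n * w + p * k = z := by
    obtain ⟨c, d, h⟩ := hn
    exact ⟨c * z, d * z, by linear_combination z * h⟩
  have c2 : IsCoprime (2 : ℤ) p := by
    rw [Int.isCoprime_iff_gcd_eq_one]
    exact (Nat.coprime_primes Nat.prime_two hp).2 (by omega)
  have c3 : IsCoprime (3 : ℤ) p := by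
    rw [Int.isCoprime_iff_gcd_eq_one]
    exact (Nat.coprime_primes Nat.prime_three hp).2 (by omega)
  obtain ⟨w3, k3, hw3⟩ := solve (c2.mul_left c3) y
  obtain ⟨w4, k4, hw4⟩ := solve c3 (6 * w3 - x)
  have zero7 {n k : ℤ} (h : n = p * k) : n • φ e7 = 0 := by
    rw [h, mul_comm, mul_smul, ← map_zsmul, p7, smul_zero]
  let a' : Cover ℤ := ea + (2 * w3) • eb
  let b' : Cover ℤ := eb + w3 • e3 + w4 • e4
  let v2 := ⁅b', a'⁆
  let v3 := ⁅v2, a'⁆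
  let v4 := ⁅v3, a'⁆
  let v5 := ⁅v4, a'⁆
  let v6 := ⁅v5, a'⁆
  have ha' : a' = ⟨1, 2 * w3, 0, 0, 0, 0, 0, 0, 0, 0⟩ := by
    ext <;> simp [a', ea, eb, add_def, zsmul_def]
  have hb' : b' = ⟨0, 1, 0, w3, w4, 0, 0, 0, 0, 0⟩ := by
    ext <;> simp [b', eb, e3, e4, add_def, zsmul_def]
  have hv2 : v2 = ⟨0, 0, 1, 0, w3, w4, 2 * w3 * (w3 + w4), 0, 0, 2 * w3 * w4⟩ := by
    ext <;> simp only [v2, ha', hb', lie_def] <;> ring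
  have hv3 : v3 = ⟨0, 0, 0, 1, 0, 3 * w3, w4 + 2 * w3 ^ 2, 2 * w3 * (w3 + 3 * w4), 2 * w3,
      2 * w3 ^ 2⟩ := by
    ext <;> simp only [v3, hv2, ha', lie_def] <;> ring
  have hv4 : v4 = ⟨0, 0, 0, 0, 1, 0, 5 * w3, w4 + 14 * w3 ^ 2, 0, 0⟩ := by
    ext <;> simp only [v4, hv3, ha', lie_def] <;> ring
  have hv5 : v5 = ⟨0, 0, 0, 0, 0, 1, 2 * w3, 5 * w3, 0, 2 * w3⟩ := by
    ext <;> simp only [v5, hv4, ha', lie_def] <;> ring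
  have hv6 : v6 = ⟨0, 0, 0, 0, 0, 0, 1, 6 * w3, 0, 0⟩ := by
    ext <;> simp only [v6, hv5, ha', lie_def] <;> ring
  have h7' : ⁅v6, a'⁆ = e7 := by
    ext <;> simp only [hv6, ha', e7, lie_def] <;> ring
  have h6b : ⁅v6, b'⁆ = 0 := by
    ext <;> simp only [hv6, hb', zero_def, lie_def] <;> ring
  have hX' : ⁅v2, b'⁆ = v5 + (eX + (3 * w4 - 6 * w3) • e7) := by
    ext <;> simp only [hv2, hv5, hb', eX, e7, lie_def, add_def, zsmul_def, Int.cast_id] <;> ring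
  have hY' : ⁅v4, b'⁆ = v6 + (eY + (-6 * w3) • e7) := by
    ext <;> simp only [hv4, hv6, hb', eY, e7, lie_def, add_def, zsmul_def, Int.cast_id] <;> ring
  have hφX : φ (eX + (3 * w4 - 6 * w3) • e7) = 0 := by
    rw [map_add, map_zsmul, hx, ← add_smul]
    exact zero7 (k := -k4) (by linear_combination hw4)
  have hφY : φ (eY + (-6 * w3) • e7) = 0 := by
    rw [map_add, map_zsmul, hy, ← add_smul]
    exact zero7 (k := k3) (by linear_combination -hw3)
  obtain ⟨ψ, ψa, ψb⟩ := Cover.exists_hom (a := φ a') (b := φ b') (v2 := φ v2) (v3 := φ v3)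
    (v4 := φ v4) (v5 := φ v5) (v6 := φ v6) (v7 := φ e7) (X := 0) (Y := 0) (φ.map_lie _ _).symm
    (φ.map_lie _ _).symm (φ.map_lie _ _).symm (φ.map_lie _ _).symm (φ.map_lie _ _).symm
    (by rw [← LieHom.map_lie, h7']) (by rw [← LieHom.map_lie, hX', map_add, hφX])
    (by rw [← LieHom.map_lie, hY', map_add, hφY]) zero_lie zero_lie
    (central (map_mem_lcs φ e7_mem_lcs))
    (fun l => by rw [← LieHom.map_lie, h6b, map_zero, zero_lie])
  have ψ2 : ψ e2 = φ v2 := by rw [← lie_eb_ea, LieHom.map_lie, ψa, ψb, ← LieHom.map_lie]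
  have ψ3 : ψ e3 = φ v3 := by rw [← lie_e2_ea, LieHom.map_lie, ψa, ψ2, ← LieHom.map_lie]
  have ψ4 : ψ e4 = φ v4 := by rw [← lie_e3_ea, LieHom.map_lie, ψa, ψ3, ← LieHom.map_lie]
  have ψ5 : ψ e5 = φ v5 := by rw [← lie_e4_ea, LieHom.map_lie, ψa, ψ4, ← LieHom.map_lie]
  have ψ6 : ψ e6 = φ v6 := by rw [← lie_e5_ea, LieHom.map_lie, ψa, ψ5, ← LieHom.map_lie]
  have ψ7 : ψ e7 = φ e7 := by rw [← lie_e6_ea, LieHom.map_lie, ψa, ψ6, ← LieHom.map_lie, h7',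
    lie_e6_ea]
  have ψX : ψ eX = 0 := by
    have h : ψ eX = ψ ⁅e2, eb⁆ - ψ e5 := by rw [lie_e2_eb, map_add, add_sub_cancel_left]
    rw [h, LieHom.map_lie, ψ2, ψb, ψ5, ← LieHom.map_lie, hX', map_add, hφX]
    simp
  have ψY : ψ eY = 0 := by
    have h : ψ eY = ψ ⁅e4, eb⁆ - ψ e6 := by rw [lie_e4_eb, map_add, add_sub_cancel_left]
    rw [h, LieHom.map_lie, ψ4, ψb, ψ6, ← LieHom.map_lie, hY', map_add, hφY]
    simp
  have hψ : Function.Surjective ψ := by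
    let S := ψ.range.comap φ
    have mem (u v : Cover ℤ) (h : ψ u = φ v) : v ∈ S := ⟨u, h⟩
    have m7 : e7 ∈ S := mem _ _ ψ7
    have mX : eX ∈ S := mem (x • e7) _ (by rw [map_zsmul, ψ7, hx])
    have mY : eY ∈ S := mem (y • e7) _ (by rw [map_zsmul, ψ7, hy])
    have m6 : e6 ∈ S := by
      have h : e6 = v6 - v6.c7 • e7 := by
        ext <;> simp [hv6, sub_def, zsmul_def, e6, e7]
      rw [h]
      exact S.sub_mem (mem _ _ ψ6) (S.smul_mem _ m7)
    have m5 : e5 ∈ S := by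
      have h : e5 = v5 - (v5.c6 • e6 + v5.c7 • e7 + v5.y • eY) := by
        ext <;> simp [hv5, add_def, sub_def, zsmul_def, e5, e6, e7, eY]
      rw [h]
      exact S.sub_mem (mem _ _ ψ5) (S.add_mem (S.add_mem (S.smul_mem _ m6) (S.smul_mem _ m7))
        (S.smul_mem _ mY))
    have m4 : e4 ∈ S := by
      have h : e4 = v4 - (v4.c5 • e5 + v4.c6 • e6 + v4.c7 • e7 + v4.y • eY) := by
        ext <;> simp [hv4, add_def, sub_def, zsmul_def, e4, e5, e6, e7, eY]
      rw [h]
      exact S.sub_mem (mem _ _ ψ4) (S.add_mem (S.add_mem (S.add_mem (S.smul_mem _ m5)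
        (S.smul_mem _ m6)) (S.smul_mem _ m7)) (S.smul_mem _ mY))
    have m3 : e3 ∈ S := by
      have h : e3 = v3 - (v3.c4 • e4 + v3.c5 • e5 + v3.c6 • e6 + v3.c7 • e7 + v3.x • eX
          + v3.y • eY) := by
        ext <;> simp [hv3, add_def, sub_def, zsmul_def, e3, e4, e5, e6, e7, eX, eY]
      rw [h]
      exact S.sub_mem (mem _ _ ψ3) (S.add_mem (S.add_mem (S.add_mem (S.add_mem (S.add_mem
        (S.smul_mem _ m4) (S.smul_mem _ m5)) (S.smul_mem _ m6)) (S.smul_mem _ m7))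
        (S.smul_mem _ mX)) (S.smul_mem _ mY))
    have mb : eb ∈ S := by
      have h : eb = b' - (w3 • e3 + w4 • e4) := by simp only [b']; abel
      rw [h]
      exact S.sub_mem (mem _ _ ψb) (S.add_mem (S.smul_mem _ m3) (S.smul_mem _ m4))
    have ma : ea ∈ S := by
      have h : ea = a' - (2 * w3) • eb := by simp only [a']; abel
      rw [h]
      exact S.sub_mem (mem _ _ ψa) (S.smul_mem _ mb)
    intro l
    obtain ⟨g, rfl⟩ := hφ l
    exact (Cover.eq_top_of_mem S ma mb ▸ LieSubalgebra.mem_top g : g ∈ S)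
  obtain ⟨s, hs⟩ := e7mul (hφ6 ((p : ℤ) • a') (ptop _))
  obtain ⟨t, ht⟩ := e7mul (hφ6 ((p : ℤ) • b') (ptop _))
  have hle (g : Cover ℤ) (hg : g ∈ relIdeal p (s : ZMod p) t) : ψ g = 0 := by
    obtain ⟨i, j, ha, hb, ⟨k2, h2⟩, ⟨k3, h3⟩, ⟨k4, h4⟩, ⟨k5, h5⟩, ⟨k6, h6⟩, h⟩ := hg
    have h : ((g.c7 + s * i + t * j : ℤ) : ZMod p) = 0 := by exact_mod_cast h
    obtain ⟨k, hk⟩ := (ZMod.intCast_zmod_eq_zero_iff_dvd _ _).1 h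
    have hz (k : ℤ) (u v : Cover ℤ) : (p * k) • φ ⁅u, v⁆ = 0 := by
      rw [mul_comm, mul_smul, ← map_zsmul φ, pc, smul_zero]
    have hs' : (p * i) • φ a' = (s * i) • φ e7 := by
      rw [mul_comm, mul_smul, ← map_zsmul φ, hs, ← mul_smul, mul_comm]
    have ht' : (p * j) • φ b' = (t * j) • φ e7 := by
      rw [mul_comm, mul_smul, ← map_zsmul φ, ht, ← mul_smul, mul_comm]
    rw [Cover.eq_sum g]
    simp only [map_add, map_zsmul, ψa, ψb, ψ2, ψ3, ψ4, ψ5, ψ6, ψ7, ψX, ψY, ha, hb, h2, h3, h4, h5,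
      h6, v2, v3, v4, v5, v6, hz, hs', ht', smul_zero, add_zero]
    rw [← zero7 hk]
    module
  refine ⟨s, t, ψ, hψ, fun g => ⟨fun hg => ?_, hle g⟩⟩
  obtain ⟨Ψ, hΨ⟩ := exists_quot_lift _ ψ hle
  have hΨs : Function.Surjective Ψ := fun l => by
    obtain ⟨g, rfl⟩ := hψ l
    exact ⟨_, hΨ g⟩
  have : NeZero p := ⟨hp.ne_zero⟩
  have hc := natCard_quot_relIdeal p (s : ZMod p) t
  have : Finite (Cover ℤ ⧸ relIdeal p (s : ZMod p) t) :=
    Nat.finite_of_card_ne_zero (by rw [hc]; exact pow_ne_zero _ hp.ne_zero)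
  have hinj := (hΨs.bijective_of_nat_card_le (by rw [hc, hcard])).1
  rw [← quotHom_eq_zero]
  exact hinj (by rw [hΨ, hg, map_zero])

end Normalization

section Rigidity

theorem Cover.normalized_of_relations {F : Type*} [Field F] (h3 : (3 : F) ≠ 0) {u v : Cover F}
    {r1 r2 v7 : Cover F} (hr1 : ⁅⁅v, u⁆, v⁆ - ⁅⁅⁅⁅v, u⁆, u⁆, u⁆, u⁆ = r1)
    (hr2 : ⁅⁅⁅⁅v, u⁆, u⁆, u⁆, v⁆ - ⁅⁅⁅⁅⁅v, u⁆, u⁆, u⁆, u⁆, u⁆ = r2)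
    (h7 : ⁅⁅⁅⁅⁅⁅v, u⁆, u⁆, u⁆, u⁆, u⁆, u⁆ = v7) (r13 : r1.c3 = 0) (r15 : r1.c5 = 0)
    (r16 : r1.c6 = 0) (r26 : r2.c6 = 0) (r27 : r2.c7 = 0) (h77 : v7.c7 ≠ 0) :
    u.a = 1 ∧ u.b = 0 ∧ v.a = 0 ∧ v.b = 1 ∧ v7.c7 = 1 := by
  obtain ⟨α, β, u2, u3, u4, u5, u6, u7, ux, uy⟩ := u
  obtain ⟨γ, δ, w2, w3, w4, w5, w6, w7, wx, wy⟩ := v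
  subst hr1 hr2 h7
  simp only [lie_def, sub_def, zero_mul, sub_zero, add_zero, mul_zero] at *
  have hα : α ≠ 0 := by
    rintro rfl
    simp at h77
  have hΔ : δ * α - γ * β ≠ 0 := by
    intro h
    simp [h] at h77
  obtain rfl : γ = 0 := by simpa [hΔ, sub_eq_zero] using r13
  have hδ : δ ≠ 0 := by
    rintro rfl
    simp at hΔ
  simp only [zero_mul, sub_zero, zero_add, mul_zero] at *
  have e1 : δ = α ^ 3 := by
    apply mul_left_cancel₀ hΔ
    linear_combination r15
  have e2 : δ = α ^ 2 := by
    apply mul_left_cancel₀ (mul_ne_zero hΔ (pow_ne_zero 2 hα))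
    linear_combination r26
  obtain rfl : α = 1 := by
    apply mul_left_cancel₀ (pow_ne_zero 2 hα)
    linear_combination e2 - e1
  obtain rfl : δ = 1 := by simpa using e1
  simp only [one_mul, mul_one] at *
  refine ⟨trivial, ?_, trivial, trivial, trivial⟩
  apply mul_left_cancel₀ h3
  linear_combination -r27

/-- Reduction of the coefficients modulo `p`. -/
def Cover.red (p : ℕ) (g : Cover ℤ) : Cover (ZMod p) :=
  ⟨g.a, g.b, g.c2, g.c3, g.c4, g.c5, g.c6, g.c7, g.x, g.y⟩

theorem Cover.red_lie (p : ℕ) (u v : Cover ℤ) : red p ⁅u, v⁆ = ⁅red p u, red p v⁆ := by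
  simp [red, lie_def]

theorem Cover.red_sub (p : ℕ) (u v : Cover ℤ) : red p (u - v) = red p u - red p v := by
  simp [red, sub_def]

theorem coeff_of_mem_relIdeal {p : ℕ} [NeZero p] {s t : ZMod p} {g : Cover ℤ}
    (hg : g ∈ relIdeal p s t) : (g.c3 : ZMod p) = 0 ∧ (g.c5 : ZMod p) = 0 ∧
      (g.c6 : ZMod p) = 0 ∧ (g.a = 0 → g.b = 0 → (g.c7 : ZMod p) = 0) := by
  obtain ⟨i, j, ha, hb, h2, h3, h4, h5, h6, h7⟩ := hg
  have hp : p ≠ 0 := NeZero.ne p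
  simp only [ZMod.intCast_zmod_eq_zero_iff_dvd, h3, h5, h6, true_and]
  intro ha' hb'
  obtain rfl : i = 0 := by simpa [hp, ha'] using ha
  obtain rfl : j = 0 := by simpa [hp, hb'] using hb
  rw [← ZMod.intCast_zmod_eq_zero_iff_dvd]
  simpa using h7

open Cover in
theorem parameters_eq {p : ℕ} [Fact p.Prime] (h5 : 5 ≤ p) {s t s' t' : ZMod p} {L : Type*}
    [LieRing L] (φ φ' : Cover ℤ →ₗ⁅ℤ⁆ L) (hφ : Function.Surjective φ)
    (hker : ∀ g, φ g = 0 ↔ g ∈ relIdeal p s t) (hker' : ∀ g, φ' g = 0 ↔ g ∈ relIdeal p s' t') :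
    s = s' ∧ t = t' := by
  have hp : p ≠ 0 := (Fact.out : p.Prime).ne_zero
  have hpz : (p : ℤ) ≠ 0 := by exact_mod_cast hp
  have : NeZero p := ⟨hp⟩
  have h3 : (3 : ZMod p) ≠ 0 := by
    intro h
    have h' : ((3 : ℕ) : ZMod p) = 0 := by exact_mod_cast h
    have := Nat.le_of_dvd (by norm_num) ((ZMod.natCast_eq_zero_iff 3 p).1 h')
    omega
  obtain ⟨u, hu⟩ := hφ (φ' ea)
  obtain ⟨v, hv⟩ := hφ (φ' eb)
  have k2 : φ ⁅v, u⁆ = φ' e2 := by rw [← lie_eb_ea, LieHom.map_lie, LieHom.map_lie, hu, hv]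
  have k3 : φ ⁅⁅v, u⁆, u⁆ = φ' e3 := by rw [← lie_e2_ea, LieHom.map_lie, k2, hu, LieHom.map_lie]
  have k4 : φ ⁅⁅⁅v, u⁆, u⁆, u⁆ = φ' e4 := by
    rw [← lie_e3_ea, LieHom.map_lie, k3, hu, LieHom.map_lie]
  have k5 : φ ⁅⁅⁅⁅v, u⁆, u⁆, u⁆, u⁆ = φ' e5 := by
    rw [← lie_e4_ea, LieHom.map_lie, k4, hu, LieHom.map_lie]
  have k6 : φ ⁅⁅⁅⁅⁅v, u⁆, u⁆, u⁆, u⁆, u⁆ = φ' e6 := by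
    rw [← lie_e5_ea, LieHom.map_lie, k5, hu, LieHom.map_lie]
  have k7 : φ ⁅⁅⁅⁅⁅⁅v, u⁆, u⁆, u⁆, u⁆, u⁆, u⁆ = φ' e7 := by
    rw [← lie_e6_ea, LieHom.map_lie, k6, hu, LieHom.map_lie]
  have m1 : ⁅⁅v, u⁆, v⁆ - ⁅⁅⁅⁅v, u⁆, u⁆, u⁆, u⁆ ∈ relIdeal p s t := by
    rw [← hker, map_sub, LieHom.map_lie, k2, hv, k5, ← LieHom.map_lie, lie_e2_eb, map_add,
      add_sub_cancel_left, hker']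
    exact ⟨0, 0, by simp [eX]⟩
  have m2 : ⁅⁅⁅⁅v, u⁆, u⁆, u⁆, v⁆ - ⁅⁅⁅⁅⁅v, u⁆, u⁆, u⁆, u⁆, u⁆ ∈ relIdeal p s t := by
    rw [← hker, map_sub, LieHom.map_lie, k4, hv, k6, ← LieHom.map_lie, lie_e4_eb, map_add,
      add_sub_cancel_left, hker']
    exact ⟨0, 0, by simp [eY]⟩
  obtain ⟨r13, r15, r16, -⟩ := coeff_of_mem_relIdeal m1
  obtain ⟨-, -, r26, r27⟩ := coeff_of_mem_relIdeal m2
  set z := ⁅⁅⁅⁅⁅⁅v, u⁆, u⁆, u⁆, u⁆, u⁆, u⁆ with hz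
  have za : z.a = 0 ∧ z.b = 0 ∧ z.c2 = 0 ∧ z.c3 = 0 ∧ z.c4 = 0 ∧ z.c5 = 0 ∧ z.c6 = 0 := by
    have : z ∈ LieModule.lowerCentralSeries ℤ (Cover ℤ) (Cover ℤ) 6 := by
      iterate 6 apply lie_mem_lcs_succ'
      simp
    simp [coeff_of_mem_lcs.1 z this]
  obtain ⟨za, zb, z2, z3, z4, z5, z6⟩ := za
  have z7 : (z.c7 : ZMod p) ≠ 0 := by
    intro h
    have : z ∈ relIdeal p s t :=
      ⟨0, 0, by simp [za], by simp [zb], by simp [z2], by simp [z3], by simp [z4], by simp [z5],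
        by simp [z6], by simp [h]⟩
    rw [← hker, k7, hker'] at this
    simpa [e7] using (coeff_of_mem_relIdeal this).2.2.2 rfl rfl
  obtain ⟨ua, ub, va, vb, z7⟩ := normalized_of_relations h3 (u := red p u) (v := red p v) rfl rfl
    rfl (by simp only [← red_lie, ← red_sub]; exact r13)
    (by simp only [← red_lie, ← red_sub]; exact r15)
    (by simp only [← red_lie, ← red_sub]; exact r16)
    (by simp only [← red_lie, ← red_sub]; exact r26)
    (by
      simp only [← red_lie, ← red_sub]
      exact r27 (by simp [sub_def, lie_def]) (by simp [sub_def, lie_def]))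
    (by simp only [← red_lie]; exact z7)
  simp only [← red_lie, ← hz] at z7
  simp only [red] at ua ub va vb z7
  have parameter {w g : Cover ℤ} (hw : φ w = φ' g) (c : ZMod p)
      (hc : ∀ n : ℤ, (n : ZMod p) = c → (p : ℤ) • g - n • e7 ∈ relIdeal p s' t') :
      s * w.a + t * w.b = c := by
    obtain ⟨n, hn⟩ := ZMod.intCast_surjective c
    have h : (p : ℤ) • w - n • z ∈ relIdeal p s t := by
      rw [← hker, map_sub, map_zsmul, map_zsmul, k7, hw, ← map_zsmul, ← map_zsmul, ← map_sub,
        hker']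
      exact hc n hn
    obtain ⟨i, j, hi, hj, -, -, -, -, -, h⟩ := h
    simp only [sub_def, zsmul_def, za, zb, Int.cast_id, mul_zero, sub_zero] at hi hj h
    rw [← mul_left_cancel₀ hpz hi, ← mul_left_cancel₀ hpz hj] at h
    push_cast at h
    rw [CharP.cast_eq_zero, z7, hn] at h
    linear_combination h
  constructor
  · have h := parameter hu s' fun n hn =>
      ⟨1, 0, by simp [sub_def, nsmul_def, zsmul_def, ea, e7, hn]⟩
    simpa [ua, ub] using h
  · have h := parameter hv t' fun n hn =>
      ⟨0, 1, by simp [sub_def, nsmul_def, zsmul_def, eb, e7, hn]⟩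
    simpa [va, vb] using h

end Rigidity

section Parameters

variable {L L' : Type*} [LieRing L] [LieRing L'] {p : ℕ} [Fact p.Prime]

/-- `L` is the quotient of `Cover ℤ` by the ideal `relIdeal p q.1 q.2`. -/
def HasParameters (L : Type*) [LieRing L] (p : ℕ) (q : ZMod p × ZMod p) : Prop :=
  ∃ φ : Cover ℤ →ₗ⁅ℤ⁆ L, Function.Surjective φ ∧ ∀ g, φ g = 0 ↔ g ∈ relIdeal p q.1 q.2

theorem exists_hasParameters_iff (h5 : 5 ≤ p) (hcard : Nat.card L = p ^ 8) :
    (∃ q, HasParameters L p q) ↔ LieClassEq L 7 ∧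
      IsLieIso (L ⧸ LieModule.lowerCentralSeries ℤ L L 6)
        (presLie p {bab - ba4, ba3b - ba5}) := by
  constructor
  · rintro ⟨q, φ, hφ, hker⟩
    exact ⟨lieClassEq_of_ker_eq_relIdeal φ hφ hker, quot_isLieIso_of_ker_eq_relIdeal φ hφ hker⟩
  · rintro ⟨hc, hL⟩
    obtain ⟨s, t, h⟩ := exists_hom_ker_eq_relIdeal h5 hcard hc.1 hL
    exact ⟨(s, t), h⟩

theorem HasParameters.isLieIso_iff (h5 : 5 ≤ p) {q q' : ZMod p × ZMod p}
    (h : HasParameters L p q) (h' : HasParameters L' p q') : IsLieIso L L' ↔ q = q' := by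
  obtain ⟨φ, hφ, hker⟩ := h
  obtain ⟨φ', hφ', hker'⟩ := h'
  constructor
  · intro hL
    obtain ⟨f, hf⟩ := hL.exists_hom
    obtain ⟨h1, h2⟩ := parameters_eq h5 (f.comp φ) φ' (hf.2.comp hφ)
      (fun g => by rw [LieHom.comp_apply, map_eq_zero_iff f hf.1, hker]) hker'
    exact Prod.ext h1 h2
  · rintro rfl
    exact isLieIso_of_ker_eq φ φ' hφ hφ' fun g => by rw [hker, hker']

theorem exists_lieRing_hasParameters (p : ℕ) [NeZero p] (q : ZMod p × ZMod p) {α : Type*}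
    [Finite α] (hα : Nat.card α = p ^ 8) : ∃ s : LieRing α, @HasParameters α s p q := by
  have hc := natCard_quot_relIdeal p q.1 q.2
  have : Finite (Cover ℤ ⧸ relIdeal p q.1 q.2) :=
    Nat.finite_of_card_ne_zero (by rw [hc]; exact pow_ne_zero _ (NeZero.ne p))
  obtain ⟨e⟩ : Nonempty (α ≃ Cover ℤ ⧸ relIdeal p q.1 q.2) := Finite.card_eq.1 (by rw [hα, hc])
  let : LieRing α := e.lieRing
  let f : (Cover ℤ ⧸ relIdeal p q.1 q.2) →ₗ⁅ℤ⁆ α :=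
    intLieHom e.symm (map_add e.addEquiv.symm)
      fun x y => e.injective <| by simp [Equiv.bracket_def]
  refine ⟨inferInstance, f.comp (quotHom _), e.symm.surjective.comp (quotHom_surjective _),
    fun g => ?_⟩
  rw [LieHom.comp_apply, map_eq_zero_iff f e.symm.injective, quotHom_eq_zero]

end Parameters

/-- The Lie ring 7.646 : `⟨a,b | [b,a,b]-[b,a,a,a,a], [b,a,a,a,b]-[b,a,a,a,a,a],
pa, pb, class 6⟩` has `p²` descendants of order `p^8` (of maximal class 7). -/
theorem descendants_of_7_646 (p : ℕ) (hp : p.Prime) (h5 : 5 ≤ p) :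
    Nat.card (Quot (fun s t :
        {s : LieRing (Fin (p ^ 8)) //
          IsMaxClassDescendantOf p (presLie p {bab - ba4, ba3b - ba5}) s} =>
      @IsLieIso _ _ s.1 t.1)) = p ^ 2 := by
  have : Fact p.Prime := ⟨hp⟩
  have hcard : Nat.card (Fin (p ^ 8)) = p ^ 8 := by simp
  choose f hf using fun d : {s : LieRing (Fin (p ^ 8)) //
      IsMaxClassDescendantOf p (presLie p {bab - ba4, ba3b - ba5}) s} =>
    (@exists_hasParameters_iff _ d.1 _ _ h5 hcard).2 d.2
  have iso (d d' : {s : LieRing (Fin (p ^ 8)) //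
      IsMaxClassDescendantOf p (presLie p {bab - ba4, ba3b - ba5}) s}) :
      @IsLieIso _ _ d.1 d'.1 ↔ f d = f d' :=
    @HasParameters.isLieIso_iff _ _ d.1 d'.1 _ _ h5 _ _ (hf d) (hf d')
  let F := Quot.lift f fun d d' => (iso d d').1
  have hF : Function.Bijective F := by
    constructor
    · rintro ⟨d⟩ ⟨d'⟩ h
      exact Quot.sound ((iso d d').2 h)
    · intro q
      obtain ⟨s, hs⟩ := exists_lieRing_hasParameters p q hcard
      let d : {s : LieRing (Fin (p ^ 8)) //
          IsMaxClassDescendantOf p (presLie p {bab - ba4, ba3b - ba5}) s} :=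
        ⟨s, (@exists_hasParameters_iff _ s _ _ h5 hcard).1 ⟨q, hs⟩⟩
      exact ⟨Quot.mk _ d, (@HasParameters.isLieIso_iff _ _ s s _ _ h5 _ _ (hf d) hs).1
        (@IsLieIso.refl _ s)⟩
  rw [Nat.card_congr (Equiv.ofBijective F hF), Nat.card_prod, Nat.card_zmod, sq]
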